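/- For every vector ω₀ ∈ ℝ³ whose coordinates are not all of the same sign, there exist a C^∞ function H : ℝ⁶ → ℝ with H(x,y) = ⟨ω₀, r(x,y)⟩ + O³(x,y) (i.e. H − ⟨ω₀, r⟩ vanishes at the origin together with its first and second total derivatives) and a global flow Φ of X_H that is diffusive: for every A > 0 there exist a point p ∈ ℝ⁶ and times t₁, t₂ ∈ ℝ with |Φ(t₁,p)| ≤ A⁻¹ and |Φ(t₂,p)| ≥ A. -/

import Mathlib

open Filter Topology Metric Set

noncomputable section

/-- Phase space `ℝ^d × ℝ^d`, a point is `p = (x, y)`. -/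
abbrev Ph (d : ℕ) := (Fin d → ℝ) × (Fin d → ℝ)

/-- Action coordinates `r_j(p) = (x_j² + y_j²)/2`. -/
def actJ {d : ℕ} (j : Fin d) (p : Ph d) : ℝ := (p.1 j ^ 2 + p.2 j ^ 2) / 2

/-- The Hamiltonian vector field `X_H = (∂H/∂y, -∂H/∂x)`. -/
def hamVF {d : ℕ} (H : Ph d → ℝ) (p : Ph d) : Ph d :=
  (fun j => fderiv ℝ H p (0, Pi.single j 1),
   fun j => - fderiv ℝ H p (Pi.single j 1, 0))

/-- `Φ` is a global flow of the Hamiltonian vector field `X_H`. -/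
def IsGlobalFlow {d : ℕ} (H : Ph d → ℝ) (Φ : ℝ → Ph d → Ph d) : Prop :=
  (∀ p, Φ 0 p = p) ∧ (∀ s t p, Φ (s + t) p = Φ s (Φ t p)) ∧
  (∀ p t, HasDerivAt (fun τ => Φ τ p) (hamVF H (Φ t p)) t)

/-- `H(x,y) = ⟨ω, r(x,y)⟩ + O³(x,y)`: the difference `H - ⟨ω, r⟩` vanishes at the
origin together with its first and second total derivatives. -/
def IsEllipticNF {d : ℕ} (ω : Fin d → ℝ) (H : Ph d → ℝ) : Prop :=
  ∀ k ≤ 2, iteratedFDeriv ℝ k (fun p => H p - ∑ j, ω j * actJ j p) 0 = 0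

theorem exists_globalFlow_of_lipschitzWith {E : Type*} [NormedAddCommGroup E] [NormedSpace ℝ E]
    [CompleteSpace E] {v : E → E} {K : NNReal} (hK : LipschitzWith K v) (hv : ContDiff ℝ 1 v) :
    ∃ Φ : ℝ → E → E, (∀ p, Φ 0 p = p) ∧ (∀ s t p, Φ (s + t) p = Φ s (Φ t p)) ∧
      ∀ p t, HasDerivAt (fun τ => Φ τ p) (v (Φ t p)) t := by
  have hε : (0 : ℝ) < 1 / (1 + K) := by positivity
  have hloc : ∀ x : E, ∃ γ : ℝ → E, γ 0 = x ∧
      IsMIntegralCurveOn (I := modelWithCornersSelf ℝ E) γ v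
        (Ioo (-(1 / (1 + K))) (1 / (1 + K))) := by
    intro x
    have hpl : IsPicardLindelof (fun _ => v) (tmin := -(1 / (1 + K))) (tmax := 1 / (1 + K))
        ⟨0, by constructor <;> linarith⟩ x (‖v x‖₊ + 1) 0 ((1 + K) * (‖v x‖₊ + 1)) K := by
      refine .of_time_independent ?_ hK.lipschitzOnWith ?_
      · intro y hy
        have h1 := hK.dist_le_mul y x
        have h2 : ‖v y‖ ≤ ‖v x‖ + dist (v y) (v x) := by
          rw [dist_eq_norm]
          simpa using norm_add_le (v x) (v y - v x)
        have h3 : (K : ℝ) * dist y x ≤ K * (‖v x‖ + 1) := by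
          gcongr
          simpa using hy
        push_cast
        nlinarith [norm_nonneg (v x)]
      · simp only [sub_zero, zero_sub, neg_neg, max_self]
        push_cast
        field_simp
        simp
    obtain ⟨α, h0, hα⟩ := hpl.exists_eq_forall_mem_Icc_hasDerivWithinAt₀
    refine ⟨α, h0, fun t ht => ?_⟩
    have := ((hα t (Ioo_subset_Icc_self ht)).mono Ioo_subset_Icc_self).hasFDerivWithinAt
    exact this.hasMFDerivWithinAt
  have hglob : ∀ x : E, ∃ γ : ℝ → E, γ 0 = x ∧ ∀ t, HasDerivAt γ (v (γ t)) t := by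
    intro x
    obtain ⟨γ, h0, hγ⟩ := exists_isMIntegralCurve_of_isMIntegralCurveOn
      (I := modelWithCornersSelf ℝ E) (v := v)
      (contMDiff_vectorSpace_iff_contDiff.2 hv) hε hloc x
    refine ⟨γ, h0, fun t => ?_⟩
    have : HasFDerivAt γ ((1 : ℝ →L[ℝ] ℝ).smulRight (v (γ t))) t :=
      hasMFDerivAt_iff_hasFDerivAt.1 (hγ t)
    simpa using this.hasDerivAt
  choose γ h0 hγ using hglob
  refine ⟨fun t p => γ p t, h0, fun s t p => ?_, hγ⟩
  have := ODE_solution_unique_univ (v := fun _ => v) (s := fun _ => univ) (t₀ := 0)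
    (f := fun s => γ p (s + t)) (g := γ (γ p t)) (fun _ => hK.lipschitzOnWith)
    (fun s => ⟨(hγ p (s + t)).comp_add_const s t, trivial⟩)
    (fun s => ⟨hγ _ s, trivial⟩) (by simp [h0])
  exact congrFun this s

theorem exists_forall_norm_iteratedFDeriv_const_mul_le {E : Type*} [NormedAddCommGroup E]
    [NormedSpace ℝ E] {f : E → ℝ} (hf : ContDiff ℝ (⊤ : ℕ∞) f) (hs : HasCompactSupport f)
    (N : ℕ) {η : ℝ} (hη : 0 < η) :
    ∃ δ > 0, ∀ c : ℝ, |c| ≤ δ → ∀ k ≤ N, ∀ x,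
      ‖iteratedFDeriv ℝ k (fun x => c * f x) x‖ ≤ η := by
  have hb : ∀ k : ℕ, ∃ C, ∀ x, ‖iteratedFDeriv ℝ k f x‖ ≤ C := fun k =>
    (hs.iteratedFDeriv k).exists_bound_of_continuous
      (hf.continuous_iteratedFDeriv (by exact_mod_cast le_top))
  choose C hC using hb
  have hC0 : ∀ k, 0 ≤ C k := fun k => (norm_nonneg _).trans (hC k 0)
  have hS : 0 ≤ ∑ k ∈ Finset.range (N + 1), C k := Finset.sum_nonneg fun k _ => hC0 k
  refine ⟨η / (1 + ∑ k ∈ Finset.range (N + 1), C k), by positivity, fun c hc k hk x => ?_⟩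
  have hle : C k ≤ 1 + ∑ k ∈ Finset.range (N + 1), C k := by
    have := Finset.single_le_sum (fun k _ => hC0 k) (Finset.mem_range.2 (Nat.lt_succ_of_le hk))
    linarith
  have hk' : ContDiff ℝ k f := hf.of_le (by exact_mod_cast le_top)
  rw [show (fun x => c * f x) = c • f from rfl, iteratedFDeriv_const_smul_apply hk'.contDiffAt,
    norm_smul, Real.norm_eq_abs]
  calc |c| * ‖iteratedFDeriv ℝ k f x‖
      ≤ η / (1 + ∑ k ∈ Finset.range (N + 1), C k) * (1 + ∑ k ∈ Finset.range (N + 1), C k) := by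
        gcongr
        exact (hC k x).trans hle
    _ = η := by field_simp

section FlatSeries

variable {E : Type*} [NormedAddCommGroup E] [NormedSpace ℝ E] {Q : ℕ → E → ℝ}

theorem contDiff_tsum_of_geometric (hQ : ∀ n, ContDiff ℝ (⊤ : ℕ∞) (Q n))
    (hb : ∀ n, ∀ k ≤ n + 2, ∀ x, ‖iteratedFDeriv ℝ k (Q n) x‖ ≤ (1 / 2) ^ n) :
    ContDiff ℝ (⊤ : ℕ∞) fun x => ∑' n, Q n x := by
  refine contDiff_tsum_of_eventually (v := fun _ n => (1 / 2 : ℝ) ^ n) hQ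
    (fun _ _ => summable_geometric_two) fun k _ => ?_
  rw [Nat.cofinite_eq_atTop]
  filter_upwards [eventually_ge_atTop k] with n hn x
  exact hb n k (by omega) x

theorem iteratedFDeriv_tsum_of_geometric (hQ : ∀ n, ContDiff ℝ (⊤ : ℕ∞) (Q n))
    (hb : ∀ n, ∀ k ≤ n + 2, ∀ x, ‖iteratedFDeriv ℝ k (Q n) x‖ ≤ (1 / 2) ^ n)
    {k : ℕ} (hk : k ≤ 2) (x : E) :
    iteratedFDeriv ℝ k (fun x => ∑' n, Q n x) x = ∑' n, iteratedFDeriv ℝ k (Q n) x := by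
  refine iteratedFDeriv_tsum_apply (v := fun _ n => (1 / 2 : ℝ) ^ n) (N := 2)
    (fun n => (hQ n).of_le (by exact_mod_cast le_top)) (fun _ _ => summable_geometric_two)
    (fun k n x hk => hb n k ?_ x) (by exact_mod_cast hk) x
  have : k ≤ 2 := by exact_mod_cast hk
  omega

theorem lipschitzWith_fderiv_tsum_of_geometric (hQ : ∀ n, ContDiff ℝ (⊤ : ℕ∞) (Q n))
    (hb : ∀ n, ∀ k ≤ n + 2, ∀ x, ‖iteratedFDeriv ℝ k (Q n) x‖ ≤ (1 / 2) ^ n) :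
    LipschitzWith 2 (fderiv ℝ fun x => ∑' n, Q n x) := by
  have hP := contDiff_tsum_of_geometric hQ hb
  refine lipschitzWith_of_nnnorm_fderiv_le (𝕜 := ℝ)
    ((hP.fderiv_right (m := (⊤ : ℕ∞)) (by simp)).differentiable (by simp))
    fun x => ?_
  rw [← NNReal.coe_le_coe, coe_nnnorm, ← norm_iteratedFDeriv_one, norm_iteratedFDeriv_fderiv,
    iteratedFDeriv_tsum_of_geometric hQ hb le_rfl]
  exact tsum_of_norm_bounded hasSum_geometric_two fun n => hb n _ (by omega) x

end FlatSeries

section PhaseSpace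

variable {d : ℕ}

/-- The symplectic gradient as a linear map on covectors. -/
def symplecticDual (d : ℕ) : (Ph d →L[ℝ] ℝ) →L[ℝ] Ph d :=
  (ContinuousLinearMap.pi fun j => ContinuousLinearMap.apply ℝ ℝ (0, Pi.single j 1)).prod
    (-ContinuousLinearMap.pi fun j => ContinuousLinearMap.apply ℝ ℝ (Pi.single j 1, 0))

theorem hamVF_eq_symplecticDual (H : Ph d → ℝ) (p : Ph d) :
    hamVF H p = symplecticDual d (fderiv ℝ H p) := rfl

theorem Filter.EventuallyEq.hamVF_eq {H G : Ph d → ℝ} {p : Ph d} (h : H =ᶠ[𝓝 p] G) :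
    hamVF H p = hamVF G p := by
  rw [hamVF_eq_symplecticDual, hamVF_eq_symplecticDual, h.fderiv_eq]

/-- The complex coordinate `z_j = x_j + i y_j`. -/
def complexCoord (j : Fin d) : Ph d →L[ℝ] ℂ :=
  Complex.equivRealProdCLM.symm.toContinuousLinearMap ∘L
    (((ContinuousLinearMap.proj j).comp (ContinuousLinearMap.fst ℝ _ _)).prod
      ((ContinuousLinearMap.proj j).comp (ContinuousLinearMap.snd ℝ _ _)))

theorem complexCoord_apply (j : Fin d) (p : Ph d) : complexCoord j p = ⟨p.1 j, p.2 j⟩ := by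
  apply Complex.ext <;> simp [complexCoord]

theorem actJ_eq_normSq (j : Fin d) (p : Ph d) :
    actJ j p = Complex.normSq (complexCoord j p) / 2 := by
  simp [actJ, complexCoord_apply, Complex.normSq_mk, sq]

theorem contDiff_actJ (j : Fin d) {n : WithTop ℕ∞} : ContDiff ℝ n (actJ (d := d) j) := by
  unfold actJ
  fun_prop

/-- The differential of `⟨ω, r⟩`, as a linear function of the base point. -/
def fderivQuadratic (ω : Fin d → ℝ) : Ph d →L[ℝ] Ph d →L[ℝ] ℝ :=
  ∑ j, ω j •
    ((Complex.reCLM ∘L complexCoord j).smulRight (Complex.reCLM ∘L complexCoord j) +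
      (Complex.imCLM ∘L complexCoord j).smulRight (Complex.imCLM ∘L complexCoord j))

theorem fderivQuadratic_apply (ω : Fin d → ℝ) (p v : Ph d) :
    fderivQuadratic ω p v = ∑ j, ω j * (p.1 j * v.1 j + p.2 j * v.2 j) := by
  simp [fderivQuadratic, complexCoord_apply, mul_add]

theorem hasFDerivAt_quadratic (ω : Fin d → ℝ) (p : Ph d) :
    HasFDerivAt (fun p => ∑ j, ω j * actJ j p) (fderivQuadratic ω p) p := by
  unfold fderivQuadratic
  rw [sum_apply]
  refine HasFDerivAt.fun_sum (u := Finset.univ) fun j _ => ?_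
  have hx : HasFDerivAt (fun p : Ph d => p.1 j) (Complex.reCLM ∘L complexCoord j) p :=
    (Complex.reCLM ∘L complexCoord j).hasFDerivAt.congr_of_eventuallyEq
      (.of_forall fun p => by simp [complexCoord_apply])
  have hy : HasFDerivAt (fun p : Ph d => p.2 j) (Complex.imCLM ∘L complexCoord j) p :=
    (Complex.imCLM ∘L complexCoord j).hasFDerivAt.congr_of_eventuallyEq
      (.of_forall fun p => by simp [complexCoord_apply])
  refine ((((hx.pow 2).add (hy.pow 2)).mul_const 2⁻¹).const_mul (ω j)).congr_fderiv ?_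
    |>.congr_of_eventuallyEq ?_
  · ext v <;> simp [complexCoord_apply, -mul_eq_mul_left_iff] <;> ring
  · exact .of_forall fun p => by simp [actJ, div_eq_mul_inv]

/-- The resonant term `Im (z_i ^ (m + 1) * z_j ^ (n + 1))`. -/
def resonantIm (i j : Fin d) (m n : ℕ) (p : Ph d) : ℝ :=
  (complexCoord i p ^ (m + 1) * complexCoord j p ^ (n + 1)).im

theorem contDiff_resonantIm (i j : Fin d) (m n : ℕ) {k : WithTop ℕ∞} :
    ContDiff ℝ k (resonantIm i j m n) :=
  Complex.imCLM.contDiff.comp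
    (((complexCoord i).contDiff.pow _).mul ((complexCoord j).contDiff.pow _))

theorem hasFDerivAt_resonantIm (i j : Fin d) (m n : ℕ) (p : Ph d) :
    HasFDerivAt (resonantIm i j m n)
      (Complex.imCLM ∘L
        ((complexCoord i p ^ (m + 1) * ((n + 1) * complexCoord j p ^ n)) • complexCoord j +
          (complexCoord j p ^ (n + 1) * ((m + 1) * complexCoord i p ^ m)) • complexCoord i)) p := by
  have hi := (complexCoord i).hasFDerivAt (x := p) |>.pow (m + 1)
  have hj := (complexCoord j).hasFDerivAt (x := p) |>.pow (n + 1)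
  refine (Complex.imCLM.hasFDerivAt.comp p (hi.mul hj)).congr_fderiv ?_
  ext v <;> simp [mul_assoc]

theorem hamVF_quadratic_add_resonantIm (ω : Fin d → ℝ) (ε : ℝ) (i j : Fin d) (m n : ℕ) (p : Ph d)
    (V : Fin d → ℂ)
    (hV : ∀ l, V l = -Complex.I * ω l * complexCoord l p + ε * (starRingEnd ℂ)
      ((if l = j then complexCoord i p ^ (m + 1) * ((n + 1) * complexCoord j p ^ n) else 0) +
        (if l = i then complexCoord j p ^ (n + 1) * ((m + 1) * complexCoord i p ^ m) else 0))) :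
    hamVF (fun p => ∑ l, ω l * actJ l p + ε * resonantIm i j m n p) p =
      (fun l => (V l).re, fun l => (V l).im) := by
  have hD := (hasFDerivAt_quadratic ω p).add ((hasFDerivAt_resonantIm i j m n p).const_mul ε)
  have hx : ∀ k l : Fin d, complexCoord k ((Pi.single l 1, 0) : Ph d) = if l = k then 1 else 0 := by
    intro k l
    by_cases h : l = k
    · subst h
      apply Complex.ext <;> simp [complexCoord_apply]
    · apply Complex.ext <;> simp [complexCoord_apply, h, Ne.symm h]
  have hy : ∀ k l : Fin d,
      complexCoord k ((0, Pi.single l 1) : Ph d) = if l = k then Complex.I else 0 := by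
    intro k l
    by_cases h : l = k
    · subst h
      apply Complex.ext <;> simp [complexCoord_apply]
    · apply Complex.ext <;> simp [complexCoord_apply, h, Ne.symm h]
  have hF : fderiv ℝ (fun p => ∑ l, ω l * actJ l p + ε * resonantIm i j m n p) p = _ := hD.fderiv
  unfold hamVF
  rw [hF]
  generalize complexCoord i p ^ (m + 1) * ((n + 1) * complexCoord j p ^ n) = u at *
  generalize complexCoord j p ^ (n + 1) * ((m + 1) * complexCoord i p ^ m) = w at *
  refine Prod.ext (funext fun l => ?_) (funext fun l => ?_)
  · change _ = (V l).re
    rw [hV l]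
    simp only [add_apply, fderivQuadratic_apply, smul_apply,
      ContinuousLinearMap.comp_apply, hy, Complex.imCLM_apply, smul_eq_mul]
    split_ifs <;> simp [complexCoord_apply, Pi.single_apply]
  · change _ = (V l).im
    rw [hV l]
    simp only [add_apply, fderivQuadratic_apply, smul_apply,
      ContinuousLinearMap.comp_apply, hx, Complex.imCLM_apply, smul_eq_mul]
    split_ifs <;> simp [complexCoord_apply, Pi.single_apply] <;> ring

/-- The curve with `z_k(t) = A_k(t) exp (-i ω_k t)`. -/
def rotatingCurve (ω : Fin d → ℝ) (A : ℝ → Fin d → ℝ) (t : ℝ) : Ph d :=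
  (fun k => (A t k * Complex.exp (-(Complex.I * ω k * t))).re,
   fun k => (A t k * Complex.exp (-(Complex.I * ω k * t))).im)

theorem complexCoord_rotatingCurve (ω : Fin d → ℝ) (A : ℝ → Fin d → ℝ) (t : ℝ) (k : Fin d) :
    complexCoord k (rotatingCurve ω A t) = A t k * Complex.exp (-(Complex.I * ω k * t)) := by
  rw [complexCoord_apply]
  rfl

theorem norm_complexCoord_rotatingCurve (ω : Fin d → ℝ) (A : ℝ → Fin d → ℝ) (t : ℝ) (k : Fin d) :
    ‖complexCoord k (rotatingCurve ω A t)‖ = |A t k| := by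
  rw [complexCoord_rotatingCurve, norm_mul, Complex.norm_exp]
  simp

theorem actJ_rotatingCurve (ω : Fin d → ℝ) (A : ℝ → Fin d → ℝ) (t : ℝ) (k : Fin d) :
    actJ k (rotatingCurve ω A t) = A t k ^ 2 / 2 := by
  rw [actJ_eq_normSq, Complex.normSq_eq_norm_sq, norm_complexCoord_rotatingCurve, sq_abs]

theorem norm_rotatingCurve_le {ω : Fin d → ℝ} {A : ℝ → Fin d → ℝ} {t C : ℝ} (hC : 0 ≤ C)
    (h : ∀ k, |A t k| ≤ C) : ‖rotatingCurve ω A t‖ ≤ C := by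
  refine max_le ((pi_norm_le_iff_of_nonneg hC).2 fun k => ?_)
    ((pi_norm_le_iff_of_nonneg hC).2 fun k => ?_)
  · refine le_trans ?_ (h k)
    rw [← norm_complexCoord_rotatingCurve ω, complexCoord_apply]
    exact Complex.abs_re_le_norm ⟨_, _⟩
  · refine le_trans ?_ (h k)
    rw [← norm_complexCoord_rotatingCurve ω, complexCoord_apply]
    exact Complex.abs_im_le_norm ⟨_, _⟩

theorem actJ_le_norm_sq (k : Fin d) (p : Ph d) : actJ k p ≤ ‖p‖ ^ 2 := by
  have h1 : p.1 k ^ 2 ≤ ‖p‖ ^ 2 :=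
    sq_le_sq' (neg_le_of_abs_le ((norm_le_pi_norm p.1 k).trans (norm_fst_le p)))
      ((le_abs_self _).trans ((norm_le_pi_norm p.1 k).trans (norm_fst_le p)))
  have h2 : p.2 k ^ 2 ≤ ‖p‖ ^ 2 :=
    sq_le_sq' (neg_le_of_abs_le ((norm_le_pi_norm p.2 k).trans (norm_snd_le p)))
      ((le_abs_self _).trans ((norm_le_pi_norm p.2 k).trans (norm_snd_le p)))
  unfold actJ
  linarith

theorem hasDerivAt_rotatingCurve (ω : Fin d → ℝ) {A : ℝ → Fin d → ℝ} {A' : Fin d → ℝ} {t : ℝ}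
    (hA : ∀ k, HasDerivAt (fun t => A t k) (A' k) t) :
    HasDerivAt (rotatingCurve ω A)
      (fun k => ((A' k - Complex.I * ω k * A t k) * Complex.exp (-(Complex.I * ω k * t))).re,
       fun k => ((A' k - Complex.I * ω k * A t k) * Complex.exp (-(Complex.I * ω k * t))).im) t := by
  have hz : ∀ k, HasDerivAt (fun t : ℝ => (A t k * Complex.exp (-(Complex.I * ω k * t)) : ℂ))
      ((A' k - Complex.I * ω k * A t k) * Complex.exp (-(Complex.I * ω k * t))) t := by
    intro k
    have h1 : HasDerivAt (fun t : ℝ => Complex.exp (-(Complex.I * ω k * t)))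
        (Complex.exp (-(Complex.I * ω k * t)) * -(Complex.I * ω k * 1)) t :=
      ((Complex.ofRealCLM.hasDerivAt (x := t)).const_mul (Complex.I * (ω k : ℂ))).neg.cexp
    refine ((hA k).ofReal_comp.mul h1).congr_deriv ?_
    ring
  refine HasDerivAt.prodMk (hasDerivAt_pi.2 fun k => ?_) (hasDerivAt_pi.2 fun k => ?_)
  · exact (Complex.reCLM.hasFDerivAt.comp_hasDerivAt t (hz k))
  · exact (Complex.imCLM.hasFDerivAt.comp_hasDerivAt t (hz k))

/-- The amplitudes of an orbit escaping along the resonance `(m + 1) ω_i + (n + 1) ω_j = 0`. -/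
def resonantAmplitude (i j : Fin d) (m n : ℕ) (ρ : ℝ → ℝ) (c : Fin d → ℝ) (t : ℝ) (k : Fin d) : ℝ :=
  if k = i then √(m + 1) * ρ t else if k = j then √(n + 1) * ρ t else c k

theorem hasDerivAt_resonant_rotatingCurve {ω : Fin d → ℝ} {i j : Fin d} (hij : i ≠ j) {m n : ℕ}
    (hω : (m + 1) * ω i + (n + 1) * ω j = 0) {ε : ℝ} {ρ : ℝ → ℝ} (c : Fin d → ℝ) {t : ℝ}
    (hρ : HasDerivAt ρ (ε * (√(m + 1) ^ (m + 1) * √(n + 1) ^ (n + 1)) * ρ t ^ (m + n + 1)) t) :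
    HasDerivAt (rotatingCurve ω (resonantAmplitude i j m n ρ c))
      (hamVF (fun p => ∑ l, ω l * actJ l p + ε * resonantIm i j m n p)
        (rotatingCurve ω (resonantAmplitude i j m n ρ c) t)) t := by
  set A := resonantAmplitude i j m n ρ c with hA
  set r' := ε * (√(m + 1) ^ (m + 1) * √(n + 1) ^ (n + 1)) * ρ t ^ (m + n + 1) with hr'
  have hAd : ∀ k, HasDerivAt (fun t => A t k)
      (if k = i then √(m + 1) * r' else if k = j then √(n + 1) * r' else 0) t := by
    intro k
    simp only [hA, resonantAmplitude]
    split_ifs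
    · exact hρ.const_mul _
    · exact hρ.const_mul _
    · exact hasDerivAt_const _ _
  refine (hasDerivAt_rotatingCurve ω hAd).congr_deriv ?_
  refine (hamVF_quadratic_add_resonantIm ω ε i j m n _ _ fun k => ?_).symm
  simp only [complexCoord_rotatingCurve]
  have hc : ∀ k, (starRingEnd ℂ) (Complex.exp (-(Complex.I * ω k * t))) *
      Complex.exp (-(Complex.I * ω k * t)) = 1 := by
    intro k
    rw [← Complex.exp_conj, ← Complex.exp_add]
    simp
  have he : Complex.exp (-(Complex.I * ω i * t)) ^ (m + 1) *
      Complex.exp (-(Complex.I * ω j * t)) ^ (n + 1) = 1 := by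
    rw [← Complex.exp_nat_mul, ← Complex.exp_nat_mul, ← Complex.exp_add, ← Complex.exp_zero]
    congr 1
    have : ((m + 1 : ℂ) * ω i + (n + 1) * ω j) = 0 := by exact_mod_cast congrArg Complex.ofReal hω
    push_cast
    linear_combination (-Complex.I * t) * this
  have hf := congrArg (starRingEnd ℂ) he
  have hm : ((√(m + 1 : ℝ) : ℝ) : ℂ) ^ 2 = m + 1 := by
    rw [← Complex.ofReal_pow, Real.sq_sqrt (by positivity)]
    push_cast
    rfl
  have hn : ((√(n + 1 : ℝ) : ℝ) : ℂ) ^ 2 = n + 1 := by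
    rw [← Complex.ofReal_pow, Real.sq_sqrt (by positivity)]
    push_cast
    rfl
  have hci := hc i
  have hcj := hc j
  have hAi : A t i = √(m + 1) * ρ t := by simp [hA, resonantAmplitude]
  have hAj : A t j = √(n + 1) * ρ t := by simp [hA, resonantAmplitude, hij.symm]
  simp only [map_mul, map_pow, map_one] at hf
  generalize hEi : Complex.exp (-(Complex.I * ω i * t)) = Ei at *
  generalize hEj : Complex.exp (-(Complex.I * ω j * t)) = Ej at *
  generalize hFi : (starRingEnd ℂ) Ei = Fi at *
  generalize hFj : (starRingEnd ℂ) Ej = Fj at *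
  have hFi' : Fi ^ m * Fj ^ (n + 1) = Ei := by
    linear_combination Ei * hf - Fi ^ m * Fj ^ (n + 1) * hci
  have hFj' : Fi ^ (m + 1) * Fj ^ n = Ej := by
    linear_combination Ej * hf - Fi ^ (m + 1) * Fj ^ n * hcj
  by_cases hki : k = i
  · subst hki
    simp only [hij, if_true, if_false, hAi, hAj, hEi, hr', zero_add, map_mul, map_pow, map_add,
      map_one, map_natCast, Complex.conj_ofReal, hFi, hFj]
    push_cast
    rw [← hm]
    conv_lhs => rw [← hFi']
    conv_rhs => rw [← hFi']
    ring
  · by_cases hkj : k = j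
    · subst hkj
      simp only [hij.symm, if_true, if_false, hAi, hAj, hEj, hr', add_zero, map_mul, map_pow,
        map_add, map_one, map_natCast, Complex.conj_ofReal, hFi, hFj]
      push_cast
      rw [← hn]
      conv_lhs => rw [← hFj']
      conv_rhs => rw [← hFj']
      ring
    · simp [hki, hkj]
      ring

end PhaseSpace

theorem exists_hasDerivAt_pow_of_le {κ : ℝ} (hκ : 0 < κ) {M : ℕ} (hM : M ≠ 0) {a b : ℝ}
    (ha : 0 < a) (hab : a ≤ b) :
    ∃ (ρ : ℝ → ℝ) (T : ℝ), 0 ≤ T ∧ ρ 0 = a ∧ ρ T = b ∧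
      ∀ t ∈ Icc 0 T, HasDerivAt ρ (κ * ρ t ^ (M + 1)) t ∧ 0 < ρ t ∧ ρ t ≤ b := by
  have hb : 0 < b := ha.trans_le hab
  have hMp : (0 : ℝ) < M := by exact_mod_cast Nat.pos_of_ne_zero hM
  have hinv : (b ^ M)⁻¹ ≤ (a ^ M)⁻¹ := by gcongr
  have hroot : ∀ x : ℝ, 0 < x → ((x ^ M)⁻¹) ^ (-(M : ℝ)⁻¹) = x := by
    intro x hx
    rw [Real.rpow_neg (by positivity), ← Real.inv_rpow (by positivity), inv_inv,
      Real.pow_rpow_inv_natCast hx.le hM]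
  refine ⟨fun t => ((a ^ M)⁻¹ - M * κ * t) ^ (-(M : ℝ)⁻¹),
    ((a ^ M)⁻¹ - (b ^ M)⁻¹) / (M * κ), div_nonneg (by linarith) (by positivity), ?_, ?_, ?_⟩
  · simpa using hroot a ha
  · convert hroot b hb using 2
    field_simp
    ring
  · intro t ht
    have hbase : (b ^ M)⁻¹ ≤ (a ^ M)⁻¹ - M * κ * t := by
      have := ht.2
      rw [le_div_iff₀ (by positivity)] at this
      linarith
    have hpos : 0 < (a ^ M)⁻¹ - M * κ * t := lt_of_lt_of_le (by positivity) hbase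
    refine ⟨?_, Real.rpow_pos_of_pos hpos _, ?_⟩
    · have h1 : HasDerivAt (fun t => (a ^ M)⁻¹ - M * κ * t) (-(M * κ * 1)) t :=
        ((hasDerivAt_id t).const_mul (M * κ)).const_sub _
      refine (h1.rpow_const (Or.inl hpos.ne')).congr_deriv ?_
      beta_reduce
      rw [← Real.rpow_mul_natCast hpos.le]
      have : -(M : ℝ)⁻¹ * ((M + 1 : ℕ) : ℝ) = -(M : ℝ)⁻¹ - 1 := by
        push_cast
        field_simp
        ring
      rw [this]
      field_simp
    · conv_rhs => rw [← hroot b hb]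
      exact Real.rpow_le_rpow_of_nonpos (by positivity) hbase (by simp)

theorem exists_resonant_shift {x y : ℝ} (hxy : x * y < 0) {δ : ℝ} (hδ : 0 < δ) :
    ∃ (c : ℝ) (m n : ℕ), |c| ≤ δ ∧ m ≠ 0 ∧ ((m : ℝ) + 1) * (x + c) + (n + 1) * y = 0 := by
  have hy : y ≠ 0 := by rintro rfl; simp at hxy
  have hq : 0 < -x / y := by
    rw [show -x / y = -(x * y) / y ^ 2 by field_simp]
    exact div_pos (by linarith) (by positivity)
  obtain ⟨q, hq1, hq2⟩ := exists_rat_btwn (lt_add_of_pos_right (-x / y) (div_pos hδ (abs_pos.2 hy)))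
  have hq0 : 0 < q := by exact_mod_cast hq.trans hq1
  have hnum : 0 < q.num := Rat.num_pos.2 hq0
  have hden := q.den_pos
  refine ⟨-x - q * y, 2 * q.den - 1, 2 * q.num.toNat - 1, ?_, by omega, ?_⟩
  · rw [show -x - q * y = (-x / y - q) * y by field_simp, abs_mul]
    rw [← le_div_iff₀ (abs_pos.2 hy), abs_le]
    constructor <;> linarith [div_pos hδ (abs_pos.2 hy)]
  · have h1 : ((2 * q.den - 1 : ℕ) : ℝ) + 1 = 2 * q.den := by
      rw [← Nat.cast_add_one, show 2 * q.den - 1 + 1 = 2 * q.den by omega]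
      push_cast
      rfl
    have h2 : ((2 * q.num.toNat - 1 : ℕ) : ℝ) + 1 = 2 * q.num := by
      rw [← Nat.cast_add_one, show 2 * q.num.toNat - 1 + 1 = 2 * q.num.toNat by omega]
      push_cast
      rw [show ((q.num.toNat : ℕ) : ℝ) = ((q.num.toNat : ℤ) : ℝ) by push_cast; rfl,
        Int.toNat_of_nonneg hnum.le]
    have h3 : (q : ℝ) * q.den = q.num := by exact_mod_cast Rat.mul_den_eq_num q
    rw [h1, h2, ← h3]
    ring

theorem abs_resonantAmplitude_le {d : ℕ} {i j : Fin d} {m n : ℕ} {ρ : ℝ → ℝ} {c : Fin d → ℝ}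
    {t X Y : ℝ} (hρ : 0 ≤ ρ t) (hX : √(m + n + 2) * ρ t ≤ X) (hY : ∀ k, |c k| ≤ Y) (k : Fin d) :
    |resonantAmplitude i j m n ρ c t k| ≤ max X Y := by
  unfold resonantAmplitude
  split_ifs
  · rw [abs_of_nonneg (by positivity)]
    refine le_trans (le_trans ?_ hX) (le_max_left _ _)
    gcongr √?_ * ρ t
    linarith [n.cast_nonneg (α := ℝ)]
  · rw [abs_of_nonneg (by positivity)]
    refine le_trans (le_trans ?_ hX) (le_max_left _ _)
    gcongr √?_ * ρ t
    linarith [m.cast_nonneg (α := ℝ)]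
  · exact (hY k).trans (le_max_right _ _)

/-- A small perturbation of `⟨ω, r⟩`, supported where `r_l` is close to `s`, which has an orbit
going from distance `max ζ √(2s)` to distance `R / 2`. -/
theorem exists_resonant_perturbation {d : ℕ} {ω : Fin d → ℝ} {i j l : Fin d} (hli : l ≠ i)
    (hlj : l ≠ j) (hω : ω i * ω j < 0) {s σ η ζ R : ℝ} (hs : 0 < s) (hσ : 0 < σ) (N : ℕ)
    (hη : 0 < η) (hζ : 0 < ζ) (hR : ζ ≤ R) :
    ∃ Q : Ph d → ℝ, ContDiff ℝ (⊤ : ℕ∞) Q ∧ (∀ k ≤ N, ∀ x, ‖iteratedFDeriv ℝ k Q x‖ ≤ η) ∧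
      (∀ p, Q p ≠ 0 → |actJ l p - s| < σ) ∧
      ∃ (γ : ℝ → Ph d) (T : ℝ), 0 ≤ T ∧
        (∀ t ∈ Icc 0 T, actJ l (γ t) = s ∧
          HasDerivAt γ (hamVF (fun p => ∑ k, ω k * actJ k p + Q p) (γ t)) t) ∧
        ‖γ 0‖ ≤ max ζ √(2 * s) ∧ R ≤ 2 * ‖γ T‖ := by
  have hij : i ≠ j := by
    rintro rfl
    exact hω.not_ge (mul_self_nonneg _)
  have hR0 : 0 < R := hζ.trans_le hR
  have hX : 0 ≤ max R √(2 * s) := hR0.le.trans (le_max_left _ _)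
  let χ : ContDiffBump s := ⟨σ / 2, σ, by positivity, by linarith⟩
  let B : ContDiffBump (0 : Ph d) :=
    ⟨max R √(2 * s) + 1, max R √(2 * s) + 2, by positivity, by linarith⟩
  let f : Ph d → ℝ := fun p => χ (actJ l p) * B p
  have hf : ContDiff ℝ (⊤ : ℕ∞) f := (χ.contDiff.comp (contDiff_actJ l)).mul B.contDiff
  have hfs : HasCompactSupport f := B.hasCompactSupport.mul_left
  have hfmem : ∀ p, f p ≠ 0 → |actJ l p - s| < σ := by
    intro p hp
    have : actJ l p ∈ Function.support χ := left_ne_zero_of_mul hp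
    rwa [χ.support_eq, mem_ball, Real.dist_eq] at this
  obtain ⟨δ, hδ, hδ'⟩ := exists_forall_norm_iteratedFDeriv_const_mul_le
    (f := fun p => f p * actJ i p) (hf.mul (contDiff_actJ i)) hfs.mul_right N (half_pos hη)
  obtain ⟨c, m, n, hc, hm, hres⟩ := exists_resonant_shift hω hδ
  obtain ⟨ε, hε, hε'⟩ := exists_forall_norm_iteratedFDeriv_const_mul_le
    (f := fun p => f p * resonantIm i j m n p) (hf.mul (contDiff_resonantIm i j m n))
    hfs.mul_right N (half_pos hη)
  have hQ1 : ContDiff ℝ (⊤ : ℕ∞) fun p => c * (f p * actJ i p) :=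
    contDiff_const.mul (hf.mul (contDiff_actJ i))
  have hQ2 : ContDiff ℝ (⊤ : ℕ∞) fun p => ε * (f p * resonantIm i j m n p) :=
    contDiff_const.mul (hf.mul (contDiff_resonantIm i j m n))
  refine ⟨(fun p => c * (f p * actJ i p)) + fun p => ε * (f p * resonantIm i j m n p),
    hQ1.add hQ2, fun k hk x => ?_, fun p hp => hfmem p fun h => hp (by simp [h]), ?_⟩
  · have h1 : ContDiff ℝ k fun p => c * (f p * actJ i p) := hQ1.of_le (by exact_mod_cast le_top)
    have h2 : ContDiff ℝ k fun p => ε * (f p * resonantIm i j m n p) :=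
      hQ2.of_le (by exact_mod_cast le_top)
    rw [iteratedFDeriv_add_apply h1.contDiffAt h2.contDiffAt]
    refine (norm_add_le _ _).trans ?_
    have := hδ' c hc k hk x
    have := hε' ε (abs_of_pos hε).le k hk x
    linarith
  · have hS : 0 < √((m : ℝ) + n + 2) := by positivity
    obtain ⟨ρ, T, hT, hρ0, hρT, hρ⟩ := exists_hasDerivAt_pow_of_le
      (κ := ε * (√(m + 1) ^ (m + 1) * √(n + 1) ^ (n + 1))) (by positivity)
      (M := m + n) (by omega) (div_pos hζ hS) (div_le_div_of_nonneg_right hR hS.le)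
    let e : Fin d → ℝ := fun k => if k = l then √(2 * s) else 0
    have he : ∀ k, |e k| ≤ √(2 * s) := by
      intro k
      simp only [e]
      split_ifs
      · exact (abs_of_nonneg (Real.sqrt_nonneg _)).le
      · simp
    let ω' : Fin d → ℝ := ω + Pi.single i c
    let γ := rotatingCurve ω' (resonantAmplitude i j m n ρ e)
    have hact : ∀ t, actJ l (γ t) = s := by
      intro t
      simp only [γ, actJ_rotatingCurve, resonantAmplitude, hli, hlj, if_false, e, if_true]
      rw [Real.sq_sqrt (by positivity)]
      ring
    refine ⟨γ, T, hT, fun t ht => ⟨hact t, ?_⟩, ?_, ?_⟩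
    · obtain ⟨hd, hpos, hle⟩ := hρ t ht
      have hγ : HasDerivAt γ
          (hamVF (fun p => ∑ l, ω' l * actJ l p + ε * resonantIm i j m n p) (γ t)) t :=
        hasDerivAt_resonant_rotatingCurve hij (by simpa [ω', hij.symm] using hres) e hd
      have hball : γ t ∈ ball (0 : Ph d) B.rIn := by
        rw [mem_ball_zero_iff]
        refine (norm_rotatingCurve_le hX (abs_resonantAmplitude_le hpos.le ?_ he)).trans_lt
          (lt_add_one _)
        rwa [le_div_iff₀' hS] at hle
      have hχ : ∀ᶠ p in 𝓝 (γ t), χ (actJ l p) = 1 := by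
        have h1 := (contDiff_actJ (d := d) l (n := 0)).continuous.tendsto (γ t)
        rw [hact] at h1
        exact h1.eventually χ.eventuallyEq_one
      have heq : (fun p => ∑ k, ω k * actJ k p + ((fun p => c * (f p * actJ i p)) +
          fun p => ε * (f p * resonantIm i j m n p)) p) =ᶠ[𝓝 (γ t)]
          fun p => ∑ l, ω' l * actJ l p + ε * resonantIm i j m n p := by
        filter_upwards [hχ, B.eventuallyEq_one_of_mem_ball hball] with p h1 h2
        have hfp : f p = 1 := by simp [f, h1, h2]
        simp [ω', hfp, add_mul, Finset.sum_add_distrib, Pi.single_apply, add_assoc]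
      rwa [heq.hamVF_eq]
    · obtain ⟨-, hpos, -⟩ := hρ 0 (left_mem_Icc.2 hT)
      refine norm_rotatingCurve_le (hζ.le.trans (le_max_left _ _))
        (abs_resonantAmplitude_le hpos.le ?_ he)
      rw [hρ0, mul_div_cancel₀ _ hS.ne']
    · have h1 := actJ_le_norm_sq i (γ T)
      have h2 := actJ_le_norm_sq j (γ T)
      have h3 : actJ i (γ T) + actJ j (γ T) = R ^ 2 / 2 := by
        simp only [γ, actJ_rotatingCurve, resonantAmplitude, hij.symm, if_true, if_false, hρT,
          mul_pow, div_pow]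
        rw [Real.sq_sqrt (by positivity), Real.sq_sqrt (by positivity),
          Real.sq_sqrt (by positivity)]
        field_simp
        ring
      refine le_of_sq_le_sq ?_ (by positivity)
      linarith

theorem lipschitzWith_symplecticDual_comp_add {d : ℕ} {ω : Fin d → ℝ} {P : Ph d → ℝ} {K : NNReal}
    (hP : Differentiable ℝ P) (hK : LipschitzWith K (fderiv ℝ P)) :
    LipschitzWith (‖symplecticDual d‖₊ * (‖fderivQuadratic ω‖₊ + K))
      (hamVF fun p => ∑ k, ω k * actJ k p + P p) := by
  have h : fderiv ℝ (fun p => ∑ k, ω k * actJ k p + P p) =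
      fun p => fderivQuadratic ω p + fderiv ℝ P p :=
    funext fun p => ((hasFDerivAt_quadratic ω p).add (hP p).hasFDerivAt).fderiv
  have h' : (hamVF fun p => ∑ k, ω k * actJ k p + P p) =
      symplecticDual d ∘ fun p => fderivQuadratic ω p + fderiv ℝ P p :=
    funext fun p => by rw [hamVF_eq_symplecticDual, h, Function.comp_apply]
  rw [h']
  exact (symplecticDual d).lipschitz.comp ((fderivQuadratic ω).lipschitz.add hK)

theorem not_both_near_of_geometric {x : ℝ} {m n : ℕ} (hmn : m ≠ n)
    (hm : |x - (1 / 4) ^ m| < (1 / 4) ^ m / 4) : ¬|x - (1 / 4) ^ n| < (1 / 4) ^ n / 4 := by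
  intro hn
  wlog h : m < n generalizing m n
  · exact this hmn.symm hn hm (lt_of_le_of_ne (not_lt.1 h) hmn.symm)
  have h1 : (1 / 4 : ℝ) ^ n ≤ (1 / 4) ^ (m + 1) :=
    pow_le_pow_of_le_one (by norm_num) (by norm_num) h
  rw [pow_succ] at h1
  have h2 : (0 : ℝ) < (1 / 4) ^ m := by positivity
  rw [abs_lt] at hm hn
  linarith

theorem statement4 (ω₀ : Fin 3 → ℝ)
    (hsign : ∃ i j : Fin 3, ω₀ i * ω₀ j < 0) :
    ∃ H : Ph 3 → ℝ, ContDiff ℝ (⊤ : ℕ∞) H ∧ IsEllipticNF ω₀ H ∧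
      ∃ Φ : ℝ → Ph 3 → Ph 3, IsGlobalFlow H Φ ∧
        ∀ A : ℝ, 0 < A → ∃ p : Ph 3, ∃ t₁ t₂ : ℝ,
          ‖Φ t₁ p‖ ≤ A⁻¹ ∧ A ≤ ‖Φ t₂ p‖ := by
  obtain ⟨i, j, hij⟩ := hsign
  obtain ⟨l, hli, hlj⟩ : ∃ l : Fin 3, l ≠ i ∧ l ≠ j := by
    clear hij
    decide +revert
  have hpert := fun n : ℕ => exists_resonant_perturbation hli hlj hij
    (s := (1 / 4) ^ n) (σ := (1 / 4) ^ n / 4) (η := (1 / 2) ^ n) (ζ := (1 / 2) ^ n)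
    (R := 2 * (n + 1)) (by positivity) (by positivity) (n + 2) (by positivity) (by positivity)
    (by
      have : (1 / 2 : ℝ) ^ n ≤ 1 := pow_le_one₀ (by norm_num) (by norm_num)
      have := n.cast_nonneg (α := ℝ)
      linarith)
  choose Q hQ hQb hQs γ T hT hγ hγ0 hγT using hpert
  have hP := contDiff_tsum_of_geometric hQ hQb
  have hquad : ContDiff ℝ (⊤ : ℕ∞) fun p : Ph 3 => ∑ k, ω₀ k * actJ k p :=
    ContDiff.sum fun k _ => contDiff_const.mul (contDiff_actJ k)
  have hH : ContDiff ℝ (⊤ : ℕ∞) fun p : Ph 3 => ∑ k, ω₀ k * actJ k p + ∑' n, Q n p := hquad.add hP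
  have hLip := lipschitzWith_symplecticDual_comp_add (ω := ω₀) (hP.differentiable (by simp))
    (lipschitzWith_fderiv_tsum_of_geometric hQ hQb)
  have hham : ContDiff ℝ 1 (hamVF fun p : Ph 3 => ∑ k, ω₀ k * actJ k p + ∑' n, Q n p) :=
    (symplecticDual 3).contDiff.comp
      ((hH.fderiv_right (m := (⊤ : ℕ∞)) (by simp)).of_le (by exact_mod_cast le_top))
  have hact : ∀ x, Tendsto (actJ l) (𝓝 x) (𝓝 (actJ (d := 3) l x)) := fun x =>
    (contDiff_actJ (d := 3) l (n := 0)).continuous.tendsto x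
  obtain ⟨Φ, hΦ⟩ := exists_globalFlow_of_lipschitzWith hLip hham
  refine ⟨_, hH, fun k hk => ?_, Φ, hΦ, fun A hA => ?_⟩
  · simp only [add_sub_cancel_left]
    rw [iteratedFDeriv_tsum_of_geometric hQ hQb hk]
    refine (tsum_congr fun n => ?_).trans tsum_zero
    have h0 : Q n =ᶠ[𝓝 0] fun _ => 0 := by
      have hlt : actJ l (0 : Ph 3) < (1 / 4) ^ n / 4 := by
        simp only [actJ, Prod.fst_zero, Prod.snd_zero, Pi.zero_apply]
        norm_num
      filter_upwards [(hact 0).eventually_lt_const hlt] with p hp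
      by_contra hne
      have := (abs_lt.1 (hQs n p hne)).1
      have : (0 : ℝ) < (1 / 4) ^ n := by positivity
      linarith
    rw [(Filter.EventuallyEq.iteratedFDeriv ℝ h0 k).eq_of_nhds]
    simp [iteratedFDeriv_fun_zero]
  · obtain ⟨n, hn⟩ : ∃ n : ℕ, 2 * (1 / 2 : ℝ) ^ n ≤ A⁻¹ ∧ A ≤ n + 1 := by
      have h1 : Tendsto (fun n : ℕ => 2 * (1 / 2 : ℝ) ^ n) atTop (𝓝 (2 * 0)) :=
        (tendsto_pow_atTop_nhds_zero_of_lt_one (by norm_num) (by norm_num)).const_mul 2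
      rw [mul_zero] at h1
      have h2 := tendsto_natCast_atTop_atTop (R := ℝ).eventually_ge_atTop A
      obtain ⟨n, ha, hb⟩ := ((h1.eventually_lt_const (inv_pos.2 hA)).and h2).exists
      exact ⟨n, ha.le, by linarith⟩
    have hcurve : ∀ t ∈ Icc 0 (T n), HasDerivAt (γ n)
        (hamVF (fun p => ∑ k, ω₀ k * actJ k p + ∑' n, Q n p) (γ n t)) t := by
      intro t ht
      obtain ⟨hs, hd⟩ := hγ n t ht
      have hnear : ∀ᶠ p in 𝓝 (γ n t), |actJ l p - (1 / 4) ^ n| < (1 / 4) ^ n / 4 := by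
        refine (((hact (γ n t)).sub_const _).abs).eventually_lt_const ?_
        rw [hs, sub_self, abs_zero]
        positivity
      have heq : (fun p => ∑ k, ω₀ k * actJ k p + ∑' n, Q n p) =ᶠ[𝓝 (γ n t)]
          fun p => ∑ k, ω₀ k * actJ k p + Q n p := by
        filter_upwards [hnear] with p hp
        rw [tsum_eq_single n fun m hm => ?_]
        by_contra hne
        exact not_both_near_of_geometric hm (hQs m p hne) hp
      rwa [heq.hamVF_eq]
    have hΦγ := ODE_solution_unique (fun _ => hLip)
      (HasDerivAt.continuousOn fun t _ => hΦ.2.2 (γ n 0) t)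
      (fun t _ => (hΦ.2.2 (γ n 0) t).hasDerivWithinAt)
      (HasDerivAt.continuousOn hcurve)
      (fun t ht => (hcurve t (Ico_subset_Icc_self ht)).hasDerivWithinAt) (hΦ.1 (γ n 0))
      (right_mem_Icc.2 (hT n))
    refine ⟨γ n 0, 0, T n, ?_, ?_⟩
    · rw [hΦ.1]
      refine ((hγ0 n).trans (max_le ?_ ?_)).trans hn.1
      · linarith [pow_pos (one_half_pos (α := ℝ)) n]
      · rw [Real.sqrt_le_left (by positivity), mul_pow, ← pow_mul, mul_comm n 2, pow_mul]
        norm_num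
    · have := hγT n
      beta_reduce at hΦγ
      rw [hΦγ]
      linarith [hn.2]
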